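/- arXiv:math/0112263 — 3 statements merged into one kernel-verified Lean document; each statement's English description precedes it below -/
import Mathlib

section
/- For every pair (T,S) consisting of a tabloid T and a standard skew tableau S of the same (shifted or unshifted) skew shape, BJ(FJ(T,S)) = (T,S); and for every pair (S',T') consisting of a tabloid S' and a standard skew tableau T' of the same shape, FJ(BJ(S',T')) = (S',T'). In other words, BJ is the inverse of FJ. -/
open scoped Classical

/-- A (possibly shifted) skew Ferrers shape `μ/λ`, given by two partitions
`μ ⊇ λ` (with distinct parts in the shifted case). -/
structure SkewShape where
  shifted : Bool
  mu : ℕ → ℕ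
  lam : ℕ → ℕ
  mu_anti : ∀ i, mu (i + 1) ≤ mu i
  lam_anti : ∀ i, lam (i + 1) ≤ lam i
  lam_le_mu : ∀ i, lam i ≤ mu i
  mu_fin : ∃ r, ∀ i, r ≤ i → mu i = 0
  mu_strict : shifted = true → ∀ i, mu (i + 1) ≠ 0 → mu (i + 1) < mu i
  lam_strict : shifted = true → ∀ i, lam (i + 1) ≠ 0 → lam (i + 1) < lam i

/-- The set of cells of the (shifted) skew Ferrers diagram (rows and columns
are 0-indexed; in the shifted case row `i` is indented by `i` cells). -/
def SkewShape.cells (sh : SkewShape) : Set (ℕ × ℕ) :=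
  {c | if sh.shifted = true then
         c.1 + sh.lam c.1 ≤ c.2 ∧ c.2 < c.1 + sh.mu c.1
       else sh.lam c.1 ≤ c.2 ∧ c.2 < sh.mu c.1}

/-- A tabloid of shape `D`: a bijective filling of the cells of `D` with the
integers `1,…,n` where `n = |D|` (normalized to be `0` outside `D`). -/
def IsTabloid (D : Set (ℕ × ℕ)) (f : ℕ × ℕ → ℕ) : Prop :=
  Set.BijOn f D (Set.Icc 1 D.ncard) ∧ ∀ c, c ∉ D → f c = 0

/-- A standard (skew) tableau: a tabloid with increasing rows and columns. -/
def IsStandard (D : Set (ℕ × ℕ)) (f : ℕ × ℕ → ℕ) : Prop :=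
  IsTabloid D f ∧ ∀ c ∈ D,
    ((c.1, c.2 + 1) ∈ D → f c < f (c.1, c.2 + 1)) ∧
    ((c.1 + 1, c.2) ∈ D → f c < f (c.1 + 1, c.2))

/-- Exchange the entries of two cells. -/
def swapCells (f : ℕ × ℕ → ℕ) (a b : ℕ × ℕ) : ℕ × ℕ → ℕ :=
  Function.update (Function.update f a (f b)) b (f a)

/-- The value of a cell, `⊤` ("infinity") outside the shape `D`. -/
noncomputable def jval (D : Set (ℕ × ℕ)) (f : ℕ × ℕ → ℕ) (c : ℕ × ℕ) : WithTop ℕ :=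
  if c ∈ D then (f c : WithTop ℕ) else ⊤

/-- One step of forward jeu de taquin: the cell whose entry the moving entry at
`c` is exchanged with (the smaller of the right and lower neighbours, cells
outside the shape counting as `∞`), provided the moving entry is not yet
stable; `none` if it is stable. -/
noncomputable def fjTarget (D : Set (ℕ × ℕ)) (f : ℕ × ℕ → ℕ) (c : ℕ × ℕ) :
    Option (ℕ × ℕ) :=
  let r := (c.1, c.2 + 1)
  let d := (c.1 + 1, c.2)
  if min (jval D f r) (jval D f d) < jval D f c then
    some (if jval D f r ≤ jval D f d then r else d)
  else none

/-- Iterated forward jeu de taquin on a pair of fillings, starting at cell `c`: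
the moves are driven by the first filling and the exchanges are performed
simultaneously in both fillings. -/
noncomputable def fjIter (D : Set (ℕ × ℕ)) :
    ℕ → ((ℕ × ℕ → ℕ) × (ℕ × ℕ → ℕ)) → ℕ × ℕ →
      ((ℕ × ℕ → ℕ) × (ℕ × ℕ → ℕ)) × (ℕ × ℕ)
  | 0, p, c => (p, c)
  | fuel + 1, p, c =>
    match fjTarget D p.1 c with
    | none => (p, c)
    | some c' => fjIter D fuel (swapCells p.1 c c', swapCells p.2 c c') c'

/-- Forward jeu de taquin in a single filling, starting at cell `c`. -/
noncomputable def fjRun (D : Set (ℕ × ℕ)) (f : ℕ × ℕ → ℕ) (c : ℕ × ℕ) :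
    ℕ × ℕ → ℕ :=
  ((fjIter D D.ncard (f, f) c).1).1

/-- The cell of the shape `D` carrying the entry `v` of the filling `f`. -/
noncomputable def cellOf (D : Set (ℕ × ℕ)) (f : ℕ × ℕ → ℕ) (v : ℕ) : ℕ × ℕ :=
  Classical.epsilon fun c => c ∈ D ∧ f c = v

/-- `MJaux D S n k T`: perform forward jeu de taquin with the entries of `T`
lying in the cells labelled `n, n-1, …, n-k+1` in `S`, in this order. -/
noncomputable def MJaux (D : Set (ℕ × ℕ)) (S : ℕ × ℕ → ℕ) (n : ℕ) :
    ℕ → (ℕ × ℕ → ℕ) → ℕ × ℕ → ℕ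
  | 0, T => T
  | k + 1, T => fjRun D (MJaux D S n k T) (cellOf D S (n - k))

/-- Modified jeu de taquin `MJ_S(T)`: perform forward jeu de taquin with the
entries of `T` in decreasing order of the labels `S` assigns to their cells. -/
noncomputable def MJ (D : Set (ℕ × ℕ)) (S T : ℕ × ℕ → ℕ) : ℕ × ℕ → ℕ :=
  MJaux D S D.ncard D.ncard T

/-- `FJaux D S₀ n k (T,S)`: perform forward jeu de taquin with the entries of the
first component in the cells labelled `n, n-1, …, n-k+1` in the fixed standard
tableau `S₀` (in this order), all transpositions being performed simultaneously
in the second component. -/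
noncomputable def FJaux (D : Set (ℕ × ℕ)) (S0 : ℕ × ℕ → ℕ) (n : ℕ) :
    ℕ → ((ℕ × ℕ → ℕ) × (ℕ × ℕ → ℕ)) → (ℕ × ℕ → ℕ) × (ℕ × ℕ → ℕ)
  | 0, p => p
  | k + 1, p => (fjIter D D.ncard (FJaux D S0 n k p) (cellOf D S0 (n - k))).1

/-- `FJ(T,S) = (S',T')`, where `T' = MJ_S(T)` and `S'` is obtained from `S` by
simultaneously performing all transpositions applied to `T` during modified
jeu de taquin with respect to `S`. -/
noncomputable def FJ (D : Set (ℕ × ℕ)) (T S : ℕ × ℕ → ℕ) :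
    (ℕ × ℕ → ℕ) × (ℕ × ℕ → ℕ) :=
  Prod.swap (FJaux D S D.ncard D.ncard (T, S))

/-- One step of backward jeu de taquin inside the subshape `E`: the cell whose
entry the moving entry at `c` is exchanged with (the larger of the left and
upper neighbours inside `E`, missing neighbours counting as `0`), provided such
a neighbour exists; `none` otherwise. -/
noncomputable def bjTarget (E : Set (ℕ × ℕ)) (f : ℕ × ℕ → ℕ) (c : ℕ × ℕ) :
    Option (ℕ × ℕ) :=
  let l := (c.1, c.2 - 1)
  let u := (c.1 - 1, c.2)
  let vl : ℕ := if 0 < c.2 ∧ l ∈ E then f l else 0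
  let vu : ℕ := if 0 < c.1 ∧ u ∈ E then f u else 0
  if (0 < c.2 ∧ l ∈ E) ∨ (0 < c.1 ∧ u ∈ E) then
    some (if vu ≤ vl then l else u)
  else none

/-- Iterated backward jeu de taquin inside the subshape `E` on a pair of
fillings, starting at cell `c`: the moves are driven by the first filling and
the exchanges are performed simultaneously in both fillings. -/
noncomputable def bjIter (E : Set (ℕ × ℕ)) :
    ℕ → ((ℕ × ℕ → ℕ) × (ℕ × ℕ → ℕ)) → ℕ × ℕ →
      ((ℕ × ℕ → ℕ) × (ℕ × ℕ → ℕ)) × (ℕ × ℕ)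
  | 0, p, c => (p, c)
  | fuel + 1, p, c =>
    match bjTarget E p.1 c with
    | none => (p, c)
    | some c' => bjIter E fuel (swapCells p.1 c c', swapCells p.2 c c') c'

/-- The elementary forward step `Jⁱ` on a pair `(T,S)`: forward jeu de taquin in
`T` with the entry lying in the cell labelled `i` in `S`, the transpositions
being performed simultaneously in `S`. -/
noncomputable def Jfwd (D : Set (ℕ × ℕ)) (i : ℕ)
    (p : (ℕ × ℕ → ℕ) × (ℕ × ℕ → ℕ)) : (ℕ × ℕ → ℕ) × (ℕ × ℕ → ℕ) :=
  (fjIter D D.ncard p (cellOf D p.2 i)).1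

/-- The elementary backward step `J_i` on a pair `(S',T')`: backward jeu de
taquin in `T'`, restricted to the subshape of cells whose entries in `S'` are
`≥ i`, with the entry of `T'` lying in the cell labelled `i` in `S'`, the
transpositions being performed simultaneously in `S'`. -/
noncomputable def Jbwd (D : Set (ℕ × ℕ)) (i : ℕ)
    (p : (ℕ × ℕ → ℕ) × (ℕ × ℕ → ℕ)) : (ℕ × ℕ → ℕ) × (ℕ × ℕ → ℕ) :=
  let q := (bjIter {c | c ∈ D ∧ i ≤ p.1 c} D.ncard (p.2, p.1) (cellOf D p.1 i)).1
  (q.2, q.1)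

/-- `BJaux D k (S',T')`: for `i = 1` to `k`, perform backward jeu de taquin in
the second component, restricted to the subshape of cells whose entries in the
current first component are `≥ i`, with the entry lying in the cell labelled
`i` in the current first component, all transpositions being performed
simultaneously in the first component. -/
noncomputable def BJaux (D : Set (ℕ × ℕ)) :
    ℕ → ((ℕ × ℕ → ℕ) × (ℕ × ℕ → ℕ)) → (ℕ × ℕ → ℕ) × (ℕ × ℕ → ℕ)
  | 0, p => p
  | i + 1, p =>
    let p' := BJaux D i p
    let q := (bjIter {c | c ∈ D ∧ i + 1 ≤ p'.1 c} D.ncard (p'.2, p'.1)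
      (cellOf D p'.1 (i + 1))).1
    (q.2, q.1)

/-- `BJ(S',T') = (T,S)`. -/
noncomputable def BJ (D : Set (ℕ × ℕ)) (S' T' : ℕ × ℕ → ℕ) :
    (ℕ × ℕ → ℕ) × (ℕ × ℕ → ℕ) :=
  Prod.swap (BJaux D D.ncard (S', T'))

/-- `JfwdList D [i₁,…,iₘ] p = Jⁱ¹(Jⁱ²(… (Jⁱᵐ p) …))`. -/
noncomputable def JfwdList (D : Set (ℕ × ℕ)) :
    List ℕ → ((ℕ × ℕ → ℕ) × (ℕ × ℕ → ℕ)) → (ℕ × ℕ → ℕ) × (ℕ × ℕ → ℕ)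
  | [], p => p
  | i :: rest, p => Jfwd D i (JfwdList D rest p)

/-- `JbwdList D [i₁,…,iₘ] p = J_{i₁}(J_{i₂}(… (J_{iₘ} p) …))`. -/
noncomputable def JbwdList (D : Set (ℕ × ℕ)) :
    List ℕ → ((ℕ × ℕ → ℕ) × (ℕ × ℕ → ℕ)) → (ℕ × ℕ → ℕ) × (ℕ × ℕ → ℕ)
  | [], p => p
  | i :: rest, p => Jbwd D i (JbwdList D rest p)

/-- `π` represents a permutation of `{1,…,n}` (it is the identity elsewhere). -/
def PermOn (n : ℕ) (π : Equiv.Perm ℕ) : Prop :=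
  ∀ i, i ∉ Set.Icc 1 n → π i = i

/-- `S_π`: the tabloid obtained from `S` by replacing every entry `i` by `π i`. -/
noncomputable def permApply (D : Set (ℕ × ℕ)) (π : Equiv.Perm ℕ)
    (S : ℕ × ℕ → ℕ) : ℕ × ℕ → ℕ :=
  fun c => if c ∈ D then π (S c) else 0

/-- Forward jeu de taquin in a single filling together with the list of cells
visited by the moving entry. -/
noncomputable def fjPath (D : Set (ℕ × ℕ)) :
    ℕ → (ℕ × ℕ → ℕ) → ℕ × ℕ → (ℕ × ℕ → ℕ) × List (ℕ × ℕ)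
  | 0, f, c => (f, [c])
  | fuel + 1, f, c =>
    match fjTarget D f c with
    | none => (f, [c])
    | some c' =>
      let q := fjPath D fuel (swapCells f c c') c'
      (q.1, c :: q.2)

/-- Backward jeu de taquin inside the subshape `E` in a single filling together
with the list of cells visited by the moving entry. -/
noncomputable def bjPath (E : Set (ℕ × ℕ)) :
    ℕ → (ℕ × ℕ → ℕ) → ℕ × ℕ → (ℕ × ℕ → ℕ) × List (ℕ × ℕ)
  | 0, f, c => (f, [c])
  | fuel + 1, f, c =>
    match bjTarget E f c with
    | none => (f, [c])
    | some c' =>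
      let q := bjPath E fuel (swapCells f c c') c'
      (q.1, c :: q.2)

def Nb (x y : ℕ × ℕ) : Prop := y = (x.1, x.2 + 1) ∨ y = (x.1 + 1, x.2)

theorem Nb.sum {x y : ℕ × ℕ} (h : Nb x y) : y.1 + y.2 = x.1 + x.2 + 1 := by
  rcases h with h | h <;> subst h <;> simp <;> omega

theorem Nb.ne {x y : ℕ × ℕ} (h : Nb x y) : x ≠ y := by
  intro e; subst e; have := h.sum; omega

theorem swapCells_app (f : ℕ × ℕ → ℕ) (a b x : ℕ × ℕ) :
    swapCells f a b x = if x = b then f a else if x = a then f b else f x := by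
  simp [swapCells, Function.update_apply]

theorem swapCells_swap (f : ℕ × ℕ → ℕ) (a b : ℕ × ℕ) :
    swapCells (swapCells f a b) b a = f := by
  funext x
  simp only [swapCells_app]
  split_ifs <;> simp_all

theorem swapCells_bijOn {D : Set (ℕ × ℕ)} {f : ℕ × ℕ → ℕ} {N : Set ℕ} {a b : ℕ × ℕ}
    (h : Set.BijOn f D N) (ha : a ∈ D) (hb : b ∈ D) : Set.BijOn (swapCells f a b) D N := by
  have e : swapCells f a b = f ∘ (Equiv.swap a b) := by
    funext x
    simp only [swapCells_app, Function.comp, Equiv.swap_apply_def]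
    split_ifs <;> simp_all
  rw [e]
  refine h.comp ⟨?_, (Equiv.injective _).injOn, ?_⟩
  · intro x hx
    simp only [Equiv.swap_apply_def]
    split_ifs <;> assumption
  · intro x hx
    refine ⟨Equiv.swap a b x, ?_, by simp⟩
    simp only [Equiv.swap_apply_def]
    split_ifs <;> assumption

theorem fjTarget_some {D : Set (ℕ × ℕ)} {T : ℕ × ℕ → ℕ} {c c' : ℕ × ℕ} (hc : c ∈ D)
    (h : fjTarget D T c = some c') :
    c' ∈ D ∧ Nb c c' ∧ T c' < T c ∧ ∀ y ∈ D, Nb c y → T c' ≤ T y := by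
  unfold fjTarget jval at h
  simp only [hc, if_true] at h
  by_cases h1 : (c.1, c.2 + 1) ∈ D <;> by_cases h2 : (c.1 + 1, c.2) ∈ D <;>
    simp only [h1, h2, if_true, if_false] at h <;>
    simp at h
  all_goals
    obtain ⟨h3, h4⟩ := h
    subst h4
    unfold Nb
    try split_ifs
    all_goals
      refine ⟨by assumption, by simp, by omega, ?_⟩
      rintro y hy (rfl | rfl) <;> first | omega | contradiction

theorem fjTarget_none {D : Set (ℕ × ℕ)} {T : ℕ × ℕ → ℕ} {c : ℕ × ℕ} (hc : c ∈ D) :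
    fjTarget D T c = none ↔ ∀ y ∈ D, Nb c y → T c ≤ T y := by
  unfold fjTarget jval Nb
  simp only [hc, if_true]
  by_cases h1 : (c.1, c.2 + 1) ∈ D <;> by_cases h2 : (c.1 + 1, c.2) ∈ D <;>
    simp only [h1, h2, if_true, if_false] <;> simp <;> grind

theorem fjTarget_some' {D : Set (ℕ × ℕ)} {T : ℕ × ℕ → ℕ} {c c' : ℕ × ℕ} (hc : c ∈ D)
    (hc' : c' ∈ D) (hn : Nb c c') (hlt : T c' < T c)
    (h : ∀ y ∈ D, Nb c y → y ≠ c' → T c' < T y) : fjTarget D T c = some c' := by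
  cases e : fjTarget D T c with
  | none => have := (fjTarget_none hc).1 e c' hc' hn; omega
  | some d =>
    obtain ⟨h1, h2, h3, h4⟩ := fjTarget_some hc e
    by_contra hne
    have := h d h1 h2 (by simpa using hne)
    have := h4 c' hc' hn
    omega

theorem bjTarget_none {E : Set (ℕ × ℕ)} {T : ℕ × ℕ → ℕ} {c : ℕ × ℕ} :
    bjTarget E T c = none ↔ ∀ y ∈ E, ¬ Nb y c := by
  obtain ⟨a, b⟩ := c
  unfold bjTarget Nb
  simp only
  constructor
  · intro h ⟨y1, y2⟩ hy hn
    simp at h hn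
    rcases hn with ⟨rfl, rfl⟩ | ⟨rfl, rfl⟩
    · exact h.1 (by omega) (by simpa using hy)
    · exact h.2 (by omega) (by simpa using hy)
  · intro h
    rw [if_neg]
    rintro (⟨h1, h2⟩ | ⟨h1, h2⟩)
    · exact h _ h2 (Or.inl (by simp; omega))
    · exact h _ h2 (Or.inr (by simp; omega))

theorem bjTarget_some {E : Set (ℕ × ℕ)} {T : ℕ × ℕ → ℕ} {c c' : ℕ × ℕ}
    (hpos : ∀ x ∈ E, 0 < T x)
    (h : bjTarget E T c = some c') :
    c' ∈ E ∧ Nb c' c ∧ ∀ y ∈ E, Nb y c → T y ≤ T c' := by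
  obtain ⟨a, b⟩ := c
  have key : ∀ y ∈ E, Nb y (a, b) →
      ((0 < b ∧ y = (a, b - 1)) ∨ (0 < a ∧ y = (a - 1, b))) := by
    rintro ⟨y1, y2⟩ hy hn
    simp [Nb] at hn ⊢
    omega
  have k1 : 0 < b → Nb (a, b - 1) (a, b) := fun h => Or.inl (by simp; omega)
  have k2 : 0 < a → Nb (a - 1, b) (a, b) := fun h => Or.inr (by simp; omega)
  have p1 := hpos (a, b - 1)
  have p2 := hpos (a - 1, b)
  unfold bjTarget at h
  simp only at h
  split at h
  case isFalse => simp at h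
  case isTrue hh =>
    simp only [Option.some.injEq] at h
    subst h
    by_cases h1 : 0 < b ∧ (a, b - 1) ∈ E <;> by_cases h2 : 0 < a ∧ (a - 1, b) ∈ E <;>
      simp only [h1, h2, if_true, if_false] at hh ⊢ <;> grind

theorem bjTarget_some' {E : Set (ℕ × ℕ)} {T : ℕ × ℕ → ℕ} {c c' : ℕ × ℕ}
    (hpos : ∀ x ∈ E, 0 < T x) (hc' : c' ∈ E) (hn : Nb c' c)
    (h : ∀ y ∈ E, Nb y c → y ≠ c' → T y < T c') : bjTarget E T c = some c' := by
  cases e : bjTarget E T c with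
  | none => exact absurd hn (bjTarget_none.1 e c' hc')
  | some d =>
    obtain ⟨h1, h2, h4⟩ := bjTarget_some hpos e
    by_contra hne
    have := h d h1 h2 (by simpa using hne)
    have := h4 c' hc' hn
    omega

structure Mid (D E : Set (ℕ × ℕ)) (i : ℕ) (T S : ℕ × ℕ → ℕ) (c : ℕ × ℕ) : Prop where
  sub : E ⊆ D
  upper : ∀ x ∈ E, ∀ y ∈ D, Nb x y → y ∈ E
  mem : c ∈ E
  lab : S c = i
  iff : ∀ x ∈ D, x ∈ E ↔ i ≤ S x
  tb : Set.BijOn T D (Set.Icc 1 D.ncard)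
  sb : Set.BijOn S D (Set.Icc 1 D.ncard)
  ord : ∀ x ∈ E, ∀ y ∈ E, Nb x y → x ≠ c → y ≠ c → T x < T y
  thru : ∀ x ∈ E, ∀ y ∈ E, Nb x c → Nb c y → T x < T y
  inc : ∀ x ∈ E, Nb x c → T x < T c

theorem Mid.pos {D E i T S c} (m : Mid D E i T S c) : ∀ x ∈ E, 0 < T x := by
  intro x hx
  have := (m.tb.mapsTo (m.sub hx)).1
  omega

theorem Mid.swap_common {D E i T S c c'} (m : Mid D E i T S c) (h : c' ∈ E) :
    swapCells S c c' c' = i ∧ (∀ x ∈ D, x ∈ E ↔ i ≤ swapCells S c c' x) ∧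
    Set.BijOn (swapCells T c c') D (Set.Icc 1 D.ncard) ∧
    Set.BijOn (swapCells S c c') D (Set.Icc 1 D.ncard) := by
  refine ⟨by simp [swapCells_app, m.lab], ?_, swapCells_bijOn m.tb (m.sub m.mem) (m.sub h),
    swapCells_bijOn m.sb (m.sub m.mem) (m.sub h)⟩
  intro x hx
  have h1 := m.iff x hx
  have h2 := m.iff c (m.sub m.mem)
  have h3 := m.iff c' (m.sub h)
  have h4 := m.mem
  simp only [swapCells_app]
  split_ifs with e1 e2
  · subst e1; tauto
  · subst e2; tauto
  · exact h1

theorem Mid.fstep {D E i T S c c'} (m : Mid D E i T S c) (h : fjTarget D T c = some c') :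
    c' ∈ E ∧ Nb c c' ∧ Mid D E i (swapCells T c c') (swapCells S c c') c' ∧
    bjTarget E (swapCells T c c') c' = some c := by
  obtain ⟨h1, h2, h3, h4⟩ := fjTarget_some (m.sub m.mem) h
  have hE := m.upper c m.mem c' h1 h2
  obtain ⟨a1, a2, a3, a4⟩ := m.swap_common hE
  have hcc := h2.ne
  have hmin : ∀ y ∈ E, Nb c y → y ≠ c' → T c' < T y := by
    intro y hy hn hne
    refine lt_of_le_of_ne (h4 y (m.sub hy) hn) fun e => hne ?_
    exact (m.tb.injOn h1 (m.sub hy) e).symm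
  have hup : ∀ y ∈ E, Nb y c' → y ≠ c → T y < T c' := by
    intro y hy hn hne
    exact m.ord y hy c' hE hn hne hcc.symm
  have M : Mid D E i (swapCells T c c') (swapCells S c c') c' := by
    refine ⟨m.sub, m.upper, hE, a1, a2, a3, a4, ?_, ?_, ?_⟩
    · intro x hx y hy hn hx' hy'
      simp only [swapCells_app, hx', hy', if_false]
      split_ifs with e1 e2 e2
      · subst e1; exact absurd e2.symm hn.ne
      · subst e1; exact hmin y hy hn hy'
      · subst e2; exact m.thru x hx c' hE hn h2
      · exact m.ord x hx y hy hn e1 e2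
    · intro x hx y hy hn1 hn2
      have s1 := h2.sum
      have s2 := hn2.sum
      have hyc : y ≠ c := by rintro rfl; omega
      have hyc' := hn2.ne.symm
      have hxc' := hn1.ne
      have l2 := m.ord c' hE y hy hn2 hcc.symm hyc
      simp only [swapCells_app, hxc', hyc, hyc', if_false]
      split_ifs with e1
      · exact l2
      · exact (hup x hx hn1 e1).trans l2
    · intro x hx hn
      have hxc' := hn.ne
      simp only [swapCells_app, hxc', if_false, if_true]
      split_ifs with e1
      · exact h3
      · exact (hup x hx hn e1).trans h3
  refine ⟨hE, h2, M, ?_⟩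
  refine bjTarget_some' M.pos m.mem h2 ?_
  intro y hy hn hne
  simp only [swapCells_app, hn.ne, hne, hcc, if_false, if_true]
  exact hup y hy hn hne

theorem Mid.bstep {D E i T S c c'} (m : Mid D E i T S c) (h : bjTarget E T c = some c') :
    c' ∈ E ∧ Nb c' c ∧ Mid D E i (swapCells T c c') (swapCells S c c') c' ∧
    fjTarget D (swapCells T c c') c' = some c := by
  obtain ⟨hE, h2, h4⟩ := bjTarget_some m.pos h
  obtain ⟨a1, a2, a3, a4⟩ := m.swap_common hE
  have hcc := h2.ne
  have h3 := m.inc c' hE h2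
  have hmax : ∀ y ∈ E, Nb y c → y ≠ c' → T y < T c' := by
    intro y hy hn hne
    refine lt_of_le_of_ne (h4 y hy hn) fun e => hne ?_
    exact (m.tb.injOn (m.sub hy) (m.sub hE) e)
  have hdn : ∀ y ∈ E, Nb c' y → y ≠ c → T c' < T y := by
    intro y hy hn hne
    exact m.ord c' hE y hy hn hcc hne
  have hin : ∀ y ∈ E, Nb y c' → T y < T c' := by
    intro y hy hn
    refine m.ord y hy c' hE hn ?_ hcc
    rintro rfl
    have := hn.sum
    have := h2.sum
    omega
  refine ⟨hE, h2, ⟨m.sub, m.upper, hE, a1, a2, a3, a4, ?_, ?_, ?_⟩, ?_⟩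
  · intro x hx y hy hn hx' hy'
    simp only [swapCells_app, hx', hy', if_false]
    split_ifs with e1 e2 e2
    · subst e1; exact absurd e2.symm hn.ne
    · subst e1; exact m.thru c' hE y hy h2 hn
    · subst e2; exact hmax x hx hn hx'
    · exact m.ord x hx y hy hn e1 e2
  · intro x hx y hy hn1 hn2
    have s1 := h2.sum
    have s2 := hn1.sum
    have hxc : x ≠ c := by rintro rfl; omega
    simp only [swapCells_app, hn1.ne, hn2.ne.symm, hxc, if_false]
    split_ifs with e1
    · exact hin x hx hn1
    · exact (hin x hx hn1).trans (hdn y hy hn2 e1)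
  · intro x hx hn
    have s1 := h2.sum
    have s2 := hn.sum
    have hxc : x ≠ c := by rintro rfl; omega
    simp only [swapCells_app, hn.ne, hxc, if_false, if_true]
    exact (hin x hx hn).trans h3
  · refine fjTarget_some' (m.sub hE) (m.sub m.mem) h2 ?_ ?_
    · simp only [swapCells_app, hcc.symm, if_false, if_true]
      exact h3
    · intro y hy hn hne
      simp only [swapCells_app, hn.ne.symm, hne, hcc.symm, if_false, if_true]
      exact hdn y (m.upper c' hE y hy hn) hn hne

abbrev Fl := (ℕ × ℕ → ℕ) × (ℕ × ℕ → ℕ)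

/-- reversible chains -/
inductive Chain (D E : Set (ℕ × ℕ)) : ℕ → Fl → ℕ × ℕ → Fl → ℕ × ℕ → Prop
  | nil (p c) : c ∈ E → Chain D E 0 p c p c
  | cons (n p c c' q d) : c ∈ E → Nb c c' → fjTarget D p.1 c = some c' →
      bjTarget E (swapCells p.1 c c') c' = some c →
      Chain D E n (swapCells p.1 c c', swapCells p.2 c c') c' q d → Chain D E (n + 1) p c q d

theorem Chain.snoc {D E n p c q d} (h : Chain D E n p c q d) : ∀ d', d' ∈ E → Nb d d' →
    fjTarget D q.1 d = some d' → bjTarget E (swapCells q.1 d d') d' = some d →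
    Chain D E (n + 1) p c (swapCells q.1 d d', swapCells q.2 d d') d' := by
  induction h with
  | nil p c hc =>
    intro d' h0 h1 h2 h3
    exact .cons _ _ _ _ _ _ hc h1 h2 h3 (.nil _ _ h0)
  | cons n p c c' q d a1 a2 a3 a4 _ ih =>
    intro d' h0 h1 h2 h3
    exact .cons _ _ _ _ _ _ a1 a2 a3 a4 (ih d' h0 h1 h2 h3)

theorem Chain.card {D E n p c q d} (h : Chain D E n p c q d) :
    ∃ F : Finset (ℕ × ℕ), ↑F ⊆ E ∧ F.card = n + 1 ∧ ∀ x ∈ F, c.1 + c.2 ≤ x.1 + x.2 := by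
  induction h with
  | nil p c hc => exact ⟨{c}, by simpa using hc, by simp, by simp⟩
  | cons n p c c' q d a1 a2 a3 a4 _ ih =>
    obtain ⟨F, f1, f2, f3⟩ := ih
    have s := a2.sum
    refine ⟨insert c F, ?_, ?_, ?_⟩
    · intro x hx
      simp at hx
      rcases hx with rfl | hx
      · exact a1
      · exact f1 hx
    · rw [Finset.card_insert_of_notMem, f2]
      intro hc
      have := f3 c hc
      omega
    · intro x hx
      simp only [Finset.mem_insert] at hx
      rcases hx with rfl | hx
      · exact le_rfl
      · have := f3 x hx
        omega

theorem Chain.frame {D E n p c q d} (h : Chain D E n p c q d) :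
    d ∈ E ∧ ∀ x, x ∉ E → q.2 x = p.2 x := by
  induction h with
  | nil p c hc => exact ⟨hc, fun _ _ => rfl⟩
  | cons n p c c' q d a1 a2 a3 a4 hch ih =>
    refine ⟨ih.1, fun x hx => ?_⟩
    rw [ih.2 x hx]
    have hc' : c' ∈ E := by cases hch <;> assumption
    have : x ≠ c := by rintro rfl; exact hx a1
    have : x ≠ c' := by rintro rfl; exact hx hc'
    simp [swapCells_app, *]

theorem Chain.fj {D E n p c q d} (h : Chain D E n p c q d) (hs : fjTarget D q.1 d = none) :
    ∀ k, n ≤ k → fjIter D k p c = (q, d) := by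
  induction h with
  | nil p c hc =>
    intro k _
    cases k <;> simp [fjIter, hs]
  | cons n p c c' q d a1 a2 a3 a4 _ ih =>
    intro k hk
    obtain ⟨k, rfl⟩ : ∃ j, k = j + 1 := ⟨k - 1, by omega⟩
    simp only [fjIter, a3]
    exact ih hs k (by omega)

theorem Chain.bj_aux {D E n p c q d} (h : Chain D E n p c q d) :
    ∀ k, bjIter E (n + k) q d = bjIter E k p c := by
  induction h with
  | nil p c hc => intro k; simp
  | cons n p c c' q d a1 a2 a3 a4 _ ih =>
    intro k
    rw [show n + 1 + k = n + (k + 1) by omega, ih]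
    simp only [bjIter, a4, swapCells_swap]

theorem Chain.bj {D E n p c q d} (h : Chain D E n p c q d) (hs : bjTarget E p.1 c = none)
    (k : ℕ) (hk : n ≤ k) : bjIter E k q d = (p, c) := by
  obtain ⟨j, rfl⟩ := Nat.exists_eq_add_of_le hk
  rw [h.bj_aux]
  cases j <;> simp [bjIter, hs]

theorem Chain.le {D E n p c q d} (h : Chain D E n p c q d) (hf : D.Finite) (hED : E ⊆ D) :
    n ≤ D.ncard := by
  obtain ⟨F, f1, f2, -⟩ := h.card
  have := Set.ncard_le_ncard (f1.trans hED) hf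
  rw [Set.ncard_coe_finset] at this
  omega

theorem Mid.fchain {D E i} (hf : D.Finite) : ∀ {T S c}, Mid D E i T S c →
    ∃ n q d, Chain D E n (T, S) c q d ∧ Mid D E i q.1 q.2 d ∧ fjTarget D q.1 d = none := by
  obtain ⟨B, hB⟩ : ∃ B, ∀ x ∈ D, x.1 + x.2 ≤ B := by
    obtain ⟨B, hB⟩ := (hf.image fun x : ℕ × ℕ => x.1 + x.2).bddAbove
    exact ⟨B, fun x hx => hB ⟨x, hx, rfl⟩⟩
  have : ∀ N T S c, Mid D E i T S c → B - (c.1 + c.2) ≤ N →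
    ∃ n q d, Chain D E n (T, S) c q d ∧ Mid D E i q.1 q.2 d ∧ fjTarget D q.1 d = none := by
    intro N
    induction N with
    | zero =>
      intro T S c m hN
      cases e : fjTarget D T c with
      | none => exact ⟨0, _, _, .nil _ _ m.mem, m, e⟩
      | some c' =>
        obtain ⟨h1, h2, -⟩ := m.fstep e
        have := hB _ (m.sub h1)
        have := h2.sum
        omega
    | succ N ih =>
      intro T S c m hN
      cases e : fjTarget D T c with
      | none => exact ⟨0, _, _, .nil _ _ m.mem, m, e⟩
      | some c' =>
        obtain ⟨h1, h2, h3, h4⟩ := m.fstep e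
        have := h2.sum
        obtain ⟨n, q, d, k1, k2, k3⟩ := ih _ _ _ h3 (by omega)
        exact ⟨n + 1, q, d, .cons _ _ _ _ _ _ m.mem h2 e h4 k1, k2, k3⟩
  intro T S c m
  exact this _ T S c m le_rfl

theorem Mid.bchain {D E i} : ∀ {T S c}, Mid D E i T S c →
    ∃ n p d, Chain D E n p d (T, S) c ∧ Mid D E i p.1 p.2 d ∧ bjTarget E p.1 d = none := by
  have : ∀ N T S c, Mid D E i T S c → c.1 + c.2 ≤ N →
    ∃ n p d, Chain D E n p d (T, S) c ∧ Mid D E i p.1 p.2 d ∧ bjTarget E p.1 d = none := by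
    intro N
    induction N with
    | zero =>
      intro T S c m hN
      cases e : bjTarget E T c with
      | none => exact ⟨0, _, _, .nil _ _ m.mem, m, e⟩
      | some c' =>
        obtain ⟨h1, h2, -⟩ := m.bstep e
        have := h2.sum
        omega
    | succ N ih =>
      intro T S c m hN
      cases e : bjTarget E T c with
      | none => exact ⟨0, _, _, .nil _ _ m.mem, m, e⟩
      | some c' =>
        obtain ⟨h1, h2, h3, h4⟩ := m.bstep e
        have := h2.sum
        obtain ⟨n, q, d, k1, k2, k3⟩ := ih _ _ _ h3 (by omega)
        have k4 := k1.snoc c m.mem h2 h4 (by simpa [swapCells_swap] using e)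
        simp only [swapCells_swap] at k4
        exact ⟨n + 1, q, d, k4, k2, k3⟩
  intro T S c m
  exact this _ T S c m le_rfl

theorem cellOf_eq {D : Set (ℕ × ℕ)} {S : ℕ × ℕ → ℕ} {c i} (hS : Set.InjOn S D) (hc : c ∈ D)
    (h : S c = i) : cellOf D S i = c := by
  have := Classical.epsilon_spec (p := fun c => c ∈ D ∧ S c = i) ⟨c, hc, h⟩
  exact hS this.1 hc (this.2.trans h.symm)

/-- state in which cells with label at least `i` are ordered -/
structure Lev (D : Set (ℕ × ℕ)) (i : ℕ) (T S : ℕ × ℕ → ℕ) : Prop where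
  tb : Set.BijOn T D (Set.Icc 1 D.ncard)
  sb : Set.BijOn S D (Set.Icc 1 D.ncard)
  upper : ∀ x ∈ D, ∀ y ∈ D, Nb x y → i ≤ S x → i ≤ S y
  ord : ∀ x ∈ D, ∀ y ∈ D, Nb x y → i ≤ S x → i ≤ S y → T x < T y

theorem lev_fstep {D : Set (ℕ × ℕ)} (hf : D.Finite) {i T S} (hL : Lev D (i + 1) T S)
    (h1 : 1 ≤ i) (h2 : i ≤ D.ncard)
    (hup : ∀ x ∈ D, ∀ y ∈ D, Nb x y → i ≤ S x → i + 1 ≤ S y) :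
    ∃ q : Fl, (fjIter D D.ncard (T, S) (cellOf D S i)).1 = q ∧ Lev D i q.1 q.2 ∧
      Jbwd D i q.swap = (S, T) ∧
      (∀ x ∈ D, q.2 x = S x ∨ (i ≤ q.2 x ∧ i ≤ S x)) := by
  obtain ⟨c, hc, hSc⟩ := hL.sb.surjOn ⟨h1, h2⟩
  rw [cellOf_eq hL.sb.injOn hc hSc]
  set E : Set (ℕ × ℕ) := {x | x ∈ D ∧ i ≤ S x} with hE
  have hno : ∀ x ∈ E, ¬ Nb x c := by
    intro x hx hn
    have := hup x hx.1 c hc hn hx.2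
    omega
  have hge : ∀ x ∈ E, x ≠ c → i + 1 ≤ S x := by
    intro x hx hne
    have := hx.2
    have : S x ≠ i := fun e => hne (hL.sb.injOn hx.1 hc (e.trans hSc.symm))
    omega
  have m : Mid D E i T S c := by
    refine ⟨fun x hx => hx.1, ?_, ⟨hc, hSc.ge⟩, hSc, ?_, hL.tb, hL.sb, ?_, ?_, ?_⟩
    · intro x hx y hy hn
      have := hup x hx.1 y hy hn hx.2
      exact ⟨hy, by omega⟩
    · intro x hx
      simp [hE, hx]
    · intro x hx y hy hn hxc hyc
      exact hL.ord x hx.1 y hy.1 hn (hge x hx hxc) (hge y hy hyc)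
    · intro x hx y hy hn
      exact absurd hn (hno x hx)
    · intro x hx hn
      exact absurd hn (hno x hx)
  obtain ⟨n, q, d, k1, k2, k3⟩ := m.fchain hf
  have hn := k1.le hf m.sub
  have hEq : {x | x ∈ D ∧ i ≤ q.2 x} = E := by
    ext x
    constructor
    · rintro ⟨hx, hx2⟩
      exact (k2.iff x hx).2 hx2
    · intro hx
      exact ⟨hx.1, (k2.iff x hx.1).1 hx⟩
  refine ⟨q, by rw [k1.fj k3 _ hn], ⟨k2.tb, k2.sb, ?_, ?_⟩, ?_, ?_⟩
  · intro x hx y hy hn hi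
    rw [← k2.iff y hy]
    exact k2.upper x ((k2.iff x hx).2 hi) y hy hn
  · intro x hx y hy hn hi hj
    have hx' := (k2.iff x hx).2 hi
    have hy' := (k2.iff y hy).2 hj
    by_cases e1 : x = d
    · subst e1
      refine lt_of_le_of_ne ((fjTarget_none hx).1 k3 y hy hn) fun e => hn.ne ?_
      exact k2.tb.injOn hx hy e
    by_cases e2 : y = d
    · subst e2
      exact k2.inc x hx' hn
    exact k2.ord x hx' y hy' hn e1 e2
  · have hd := cellOf_eq k2.sb.injOn (k2.sub k2.mem) k2.lab
    simp only [Jbwd, Prod.fst_swap, Prod.snd_swap, hd, hEq]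
    rw [show (q.1, q.2) = q from rfl, k1.bj (bjTarget_none.2 hno) _ hn]
  · intro x hx
    by_cases hxE : x ∈ E
    · exact Or.inr ⟨(k2.iff x hx).1 hxE, hxE.2⟩
    · exact Or.inl (k1.frame.2 x hxE)

theorem lev_bstep {D : Set (ℕ × ℕ)} (hf : D.Finite) {i T S} (hL : Lev D i T S)
    (h1 : 1 ≤ i) (h2 : i ≤ D.ncard) :
    ∃ q : Fl, Jbwd D i (S, T) = q.swap ∧ Lev D (i + 1) q.1 q.2 ∧
      (fjIter D D.ncard q (cellOf D q.2 i)).1 = (T, S) ∧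
      (∀ x ∈ D, S x < i → q.2 x = S x) ∧
      (∀ x ∈ D, ∀ y ∈ D, Nb x y → i ≤ q.2 x → i + 1 ≤ q.2 y) := by
  obtain ⟨c, hc, hSc⟩ := hL.sb.surjOn ⟨h1, h2⟩
  set E : Set (ℕ × ℕ) := {x | x ∈ D ∧ i ≤ S x} with hE
  have m : Mid D E i T S c := by
    refine ⟨fun x hx => hx.1, ?_, ⟨hc, hSc.ge⟩, hSc, ?_, hL.tb, hL.sb, ?_, ?_, ?_⟩
    · intro x hx y hy hn
      exact ⟨hy, hL.upper x hx.1 y hy hn hx.2⟩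
    · intro x hx
      simp [hE, hx]
    · intro x hx y hy hn hxc hyc
      exact hL.ord x hx.1 y hy.1 hn hx.2 hy.2
    · intro x hx y hy hn hn'
      exact (hL.ord x hx.1 c hc hn hx.2 hSc.ge).trans (hL.ord c hc y hy.1 hn' hSc.ge hy.2)
    · intro x hx hn
      exact hL.ord x hx.1 c hc hn hx.2 hSc.ge
  obtain ⟨n, q, d, k1, k2, k3⟩ := m.bchain
  have hn := k1.le hf m.sub
  have hno := bjTarget_none.1 k3
  have hdl := k2.lab
  have hup : ∀ x ∈ D, ∀ y ∈ D, Nb x y → i ≤ q.2 x → i + 1 ≤ q.2 y := by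
    intro x hx y hy hn hi
    have hx' := (k2.iff x hx).2 hi
    have h3 := (k2.iff y hy).1 (k2.upper x hx' y hy hn)
    have : q.2 y ≠ i := by
      intro e
      have : y = d := k2.sb.injOn hy (k2.sub k2.mem) (e.trans hdl.symm)
      subst this
      exact hno x hx' hn
    omega
  refine ⟨q, ?_, ⟨k2.tb, k2.sb, ?_, ?_⟩, ?_, ?_, hup⟩
  · simp only [Jbwd, cellOf_eq hL.sb.injOn hc hSc]
    rw [← hE, k1.bj k3 _ hn]
    rfl
  · intro x hx y hy hn hi
    exact hup x hx y hy hn (by omega)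
  · intro x hx y hy hn hi hj
    refine k2.ord x ((k2.iff x hx).2 (by omega)) y ((k2.iff y hy).2 (by omega)) hn ?_ ?_
    · rintro rfl; omega
    · rintro rfl; omega
  · rw [cellOf_eq k2.sb.injOn (k2.sub k2.mem) k2.lab]
    rw [k1.fj ?_ _ hn]
    rw [fjTarget_none hc]
    intro y hy hn'
    exact (hL.ord c hc y hy hn' hSc.ge (hL.upper c hc y hy hn' hSc.ge)).le
  · intro x hx hlt
    have hxE : x ∉ E := fun h => by have := h.2; omega
    exact (k1.frame.2 x hxE).symm

theorem BJaux_succ (D : Set (ℕ × ℕ)) (i : ℕ) (p : Fl) :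
    BJaux D (i + 1) p = Jbwd D (i + 1) (BJaux D i p) := rfl

theorem std_nb {D f} (h : IsStandard D f) : ∀ x ∈ D, ∀ y ∈ D, Nb x y → f x < f y := by
  rintro x hx y hy (rfl | rfl)
  · exact (h.2 x hx).1 hy
  · exact (h.2 x hx).2 hy

theorem part1 {D : Set (ℕ × ℕ)} (hf : D.Finite) {T S} (hT : IsTabloid D T)
    (hS : IsStandard D S) : BJ D (FJ D T S).1 (FJ D T S).2 = (T, S) := by
  set n := D.ncard with hn
  have std := std_nb hS
  have key : ∀ k, k ≤ n →
      (Lev D (n - k + 1) (FJaux D S n k (T, S)).1 (FJaux D S n k (T, S)).2 ∧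
      ∀ x ∈ D, (FJaux D S n k (T, S)).2 x = S x ∨
        (n - k + 1 ≤ (FJaux D S n k (T, S)).2 x ∧ n - k + 1 ≤ S x)) ∧
      (∀ j, k = j + 1 → Jbwd D (n - j) (FJaux D S n k (T, S)).swap
        = (FJaux D S n j (T, S)).swap) := by
    intro k
    induction k with
    | zero =>
      intro _
      refine ⟨⟨⟨hT.1, hS.1.1, ?_, ?_⟩, fun x _ => Or.inl rfl⟩, by simp⟩
      · intro x hx y hy _ hi
        have := (hS.1.1.mapsTo hx).2
        simp only [FJaux] at hi
        omega
      · intro x hx y hy _ hi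
        have := (hS.1.1.mapsTo hx).2
        simp only [FJaux] at hi
        omega
    | succ k ih =>
      intro hk
      obtain ⟨⟨L, A⟩, -⟩ := ih (by omega)
      have hcell : cellOf D S (n - k) = cellOf D (FJaux D S n k (T, S)).2 (n - k) := by
        obtain ⟨c, hc, hSc⟩ := hS.1.1.surjOn (show n - k ∈ Set.Icc 1 D.ncard from
          ⟨by omega, by omega⟩)
        rw [cellOf_eq hS.1.1.injOn hc hSc, cellOf_eq L.sb.injOn hc]
        have := A c hc
        omega
      obtain ⟨q, q1, q2, q3, q4⟩ := lev_fstep hf L (by omega) (by omega) (by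
        intro x hx y hy hnb hi
        have a1 := A x hx
        have a2 := A y hy
        have := std x hx y hy hnb
        omega)
      have hq : FJaux D S n (k + 1) (T, S) = q := by
        rw [FJaux, hcell, ← q1]
      rw [hq, show n - (k + 1) + 1 = n - k by omega]
      refine ⟨⟨q2, ?_⟩, ?_⟩
      · intro x hx
        have := A x hx
        have := q4 x hx
        omega
      · intro j hj
        obtain rfl : k = j := by omega
        rw [q3]
        rfl
  have fin : ∀ i, i ≤ n → BJaux D i (FJaux D S n n (T, S)).swap
      = (FJaux D S n (n - i) (T, S)).swap := by
    intro i
    induction i with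
    | zero => intro _; rfl
    | succ i ih =>
      intro hi
      rw [BJaux_succ, ih (by omega)]
      have := (key (n - i) (by omega)).2 (n - (i + 1)) (by omega)
      rw [show n - (n - (i + 1)) = i + 1 by omega] at this
      exact this
  have := fin n le_rfl
  simp only [BJ, FJ, ← hn]
  rw [show ((FJaux D S n n (T, S)).swap.1, (FJaux D S n n (T, S)).swap.2)
    = (FJaux D S n n (T, S)).swap from rfl, this]
  simp [FJaux]

theorem part2 {D : Set (ℕ × ℕ)} (hf : D.Finite) {S' T'} (hS : IsTabloid D S')
    (hT : IsStandard D T') : FJ D (BJ D S' T').1 (BJ D S' T').2 = (S', T') := by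
  set n := D.ncard with hn
  have std := std_nb hT
  have key0 : ∀ i, i ≤ n → Lev D (i + 1) (BJaux D i (S', T')).2 (BJaux D i (S', T')).1 := by
    intro i
    induction i with
    | zero =>
      intro _
      refine ⟨hT.1.1, hS.1, ?_, ?_⟩
      · intro x hx y hy _ hi
        exact (hS.1.mapsTo hy).1
      · intro x hx y hy hnb _ _
        exact std x hx y hy hnb
    | succ i ih =>
      intro hi
      obtain ⟨q, q1, q2, -⟩ := lev_bstep hf (ih (by omega)) (by omega) (by omega)
      rw [BJaux_succ, show BJaux D i (S', T') = ((BJaux D i (S', T')).1, (BJaux D i (S', T')).2)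
        from rfl, q1]
      exact q2
  have key1 : ∀ i, i < n →
      (fjIter D n (BJaux D (i + 1) (S', T')).swap
        (cellOf D (BJaux D (i + 1) (S', T')).1 (i + 1))).1 = (BJaux D i (S', T')).swap ∧
      ∀ x ∈ D, (BJaux D i (S', T')).1 x < i + 1 →
        (BJaux D (i + 1) (S', T')).1 x = (BJaux D i (S', T')).1 x := by
    intro i hi
    obtain ⟨q, q1, q2, q3, q4, -⟩ := lev_bstep hf (key0 i (by omega)) (by omega) (by omega)
    rw [BJaux_succ, show Jbwd D (i + 1) (BJaux D i (S', T')) = q.swap from q1]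
    exact ⟨q3, q4⟩
  have stay : ∀ i j, i ≤ j → j ≤ n → ∀ x ∈ D, (BJaux D i (S', T')).1 x ≤ i →
      (BJaux D j (S', T')).1 x = (BJaux D i (S', T')).1 x := by
    intro i j hij
    induction j, hij using Nat.le_induction with
    | base => intro _ x _ _; rfl
    | succ j hij ih =>
      intro hj x hx hle
      have h1 := ih (by omega) x hx hle
      have h2 := (key1 j (by omega)).2 x hx (by omega)
      omega
  have cell : ∀ i, i < n → cellOf D (BJaux D n (S', T')).1 (i + 1)
      = cellOf D (BJaux D (i + 1) (S', T')).1 (i + 1) := by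
    intro i hi
    have L := key0 (i + 1) (by omega)
    obtain ⟨c, hc, hSc⟩ := L.sb.surjOn (show i + 1 ∈ Set.Icc 1 D.ncard from
          ⟨by omega, by omega⟩)
    rw [cellOf_eq L.sb.injOn hc hSc, cellOf_eq (key0 n le_rfl).sb.injOn hc]
    rw [stay (i + 1) n (by omega) le_rfl c hc (by omega), hSc]
  have fin : ∀ k, k ≤ n → FJaux D (BJaux D n (S', T')).1 n k (BJaux D n (S', T')).swap
      = (BJaux D (n - k) (S', T')).swap := by
    intro k
    induction k with
    | zero => intro _; rfl
    | succ k ih =>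
      intro hk
      obtain ⟨i, hi⟩ : ∃ i, n - k = i + 1 := ⟨n - k - 1, by omega⟩
      rw [FJaux, ih (by omega), hi, cell i (by omega), ← hn, (key1 i (by omega)).1,
        show n - (k + 1) = i by omega]
  have := fin n le_rfl
  simp only [BJ, FJ, ← hn]
  rw [show ((BJaux D n (S', T')).swap.1, (BJaux D n (S', T')).swap.2)
    = (BJaux D n (S', T')).swap from rfl, Prod.snd_swap, this]
  simp [BJaux]

theorem cells_finite (sh : SkewShape) : sh.cells.Finite := by
  obtain ⟨r, hr⟩ := sh.mu_fin
  have hmono : ∀ i, sh.mu i ≤ sh.mu 0 := by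
    intro i
    induction i with
    | zero => exact le_rfl
    | succ i ih => exact (sh.mu_anti i).trans ih
  refine Set.Finite.subset (Set.finite_Iio r |>.prod (Set.finite_Iio (r + sh.mu 0))) ?_
  rintro ⟨a, b⟩ h
  simp only [SkewShape.cells, Set.mem_setOf_eq] at h
  have h1 := hmono a
  have h2 : a < r := by
    by_contra hc
    have := hr a (by omega)
    split_ifs at h <;> omega
  simp only [Set.mem_prod, Set.mem_Iio]
  split_ifs at h <;> omega

/-- `BJ` is the inverse of `FJ`: `BJ ∘ FJ = id` on pairs
(tabloid, standard skew tableau) and `FJ ∘ BJ = id` on pairs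
(tabloid, standard skew tableau), for a fixed (shifted or unshifted) skew
shape. -/
theorem bj_fj_inverse (sh : SkewShape) :
    (∀ T S : ℕ × ℕ → ℕ, IsTabloid sh.cells T → IsStandard sh.cells S →
      BJ sh.cells (FJ sh.cells T S).1 (FJ sh.cells T S).2 = (T, S)) ∧
    (∀ S' T' : ℕ × ℕ → ℕ, IsTabloid sh.cells S' → IsStandard sh.cells T' →
      FJ sh.cells (BJ sh.cells S' T').1 (BJ sh.cells S' T').2 = (S', T')) := by
  exact ⟨fun _ _ hT hS => part1 (cells_finite sh) hT hS,
    fun _ _ hS hT => part2 (cells_finite sh) hS hT⟩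
end

section
/- If (S,T) = BJ(S',T') for a tabloid S' and a standard skew tableau T' of the same (shifted or unshifted) skew shape, then the resulting tabloid S is a standard skew tableau. -/
open scoped Classical

theorem swapCells_eq (f : ℕ × ℕ → ℕ) (a b : ℕ × ℕ) :
    swapCells f a b = f ∘ Equiv.swap a b := by
  funext x
  simp only [swapCells, Function.comp, Function.update_apply, Equiv.swap_apply_def]
  split_ifs <;> simp_all

theorem isTabloid_swapCells {D : Set (ℕ × ℕ)} {f : ℕ × ℕ → ℕ} {a b : ℕ × ℕ}
    (hf : IsTabloid D f) (ha : a ∈ D) (hb : b ∈ D) : IsTabloid D (swapCells f a b) := by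
  have hmem : ∀ x, Equiv.swap a b x ∈ D ↔ x ∈ D := by
    intro x
    rw [Equiv.swap_apply_def]
    split_ifs <;> simp_all
  rw [swapCells_eq]
  refine ⟨hf.1.comp ⟨fun x hx => (hmem x).2 hx, (Equiv.swap a b).injective.injOn, ?_⟩, ?_⟩
  · intro x hx
    exact ⟨Equiv.swap a b x, (hmem x).2 hx, by simp⟩
  · intro x hx
    exact hf.2 _ (fun h => hx ((hmem x).1 h))

/-- `d` is the left or upper neighbour of `c`. -/
def NbLU (d c : ℕ × ℕ) : Prop := c = (d.1, d.2 + 1) ∨ c = (d.1 + 1, d.2)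

theorem bjTarget_none_s6 {E : Set (ℕ × ℕ)} {f : ℕ × ℕ → ℕ} {c : ℕ × ℕ}
    (h : bjTarget E f c = none) : ∀ d, NbLU d c → d ∉ E := by
  intro d hd hdE
  simp only [bjTarget] at h
  split_ifs at h with h1
  apply h1
  rcases hd with rfl | rfl
  · left; simpa using hdE
  · right; simpa using hdE

theorem bjTarget_some_s6 {E : Set (ℕ × ℕ)} {f : ℕ × ℕ → ℕ} {c c' : ℕ × ℕ}
    (hpos : ∀ x ∈ E, 0 < f x)
    (h : bjTarget E f c = some c') : c' ∈ E ∧ c'.1 + c'.2 < c.1 + c.2 := by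
  simp only [bjTarget] at h
  split_ifs at h with h1 h2 h3 h4 <;> simp only [Option.some.injEq] at h <;> subst h <;>
    grind

theorem bjIter_spec {D E : Set (ℕ × ℕ)} (hfin : E.Finite) (hED : E ⊆ D) (i : ℕ) :
    ∀ (fuel : ℕ) (T S : ℕ × ℕ → ℕ) (c : ℕ × ℕ), IsTabloid D S → (∀ x ∈ E, i ≤ S x) →
      IsTabloid D T → c ∈ E → S c = i →
      {d | d ∈ E ∧ d.1 + d.2 < c.1 + c.2}.ncard ≤ fuel →
      IsTabloid D (bjIter E fuel (T, S) c).1.1 ∧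
      IsTabloid D (bjIter E fuel (T, S) c).1.2 ∧
      (∀ x ∈ E, i ≤ (bjIter E fuel (T, S) c).1.2 x) ∧
      (∀ x, x ∉ E → (bjIter E fuel (T, S) c).1.2 x = S x) ∧
      (bjIter E fuel (T, S) c).2 ∈ E ∧
      (bjIter E fuel (T, S) c).1.2 (bjIter E fuel (T, S) c).2 = i ∧
      ∀ d, NbLU d (bjIter E fuel (T, S) c).2 → d ∉ E := by
  intro fuel
  induction fuel with
  | zero =>
    intro T S c hS hge hT hc hSc hfuel
    refine ⟨hT, hS, hge, fun _ _ => rfl, hc, hSc, ?_⟩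
    intro d hd hdE
    have hf : {d | d ∈ E ∧ d.1 + d.2 < c.1 + c.2}.Finite := hfin.subset (fun x hx => hx.1)
    have h0 := (Set.ncard_eq_zero hf).1 (Nat.le_zero.1 hfuel)
    have : d ∈ {d | d ∈ E ∧ d.1 + d.2 < c.1 + c.2} := by
      refine ⟨hdE, ?_⟩
      simp only [bjIter] at hd
      rcases hd with rfl | rfl <;> simp <;> omega
    rw [h0] at this
    exact this
  | succ fuel ih =>
    intro T S c hS hge hT hc hSc hfuel
    cases htar : bjTarget E T c with
    | none =>
      have : bjIter E (fuel + 1) (T, S) c = ((T, S), c) := by simp [bjIter, htar]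
      rw [this]
      exact ⟨hT, hS, hge, fun _ _ => rfl, hc, hSc, bjTarget_none_s6 htar⟩
    | some c' =>
      have : bjIter E (fuel + 1) (T, S) c =
          bjIter E fuel (swapCells T c c', swapCells S c c') c' := by simp [bjIter, htar]
      rw [this]
      obtain ⟨hc', hlt⟩ := bjTarget_some_s6 (fun x hx => (hT.1.mapsTo (hED hx)).1) htar
      have key := ih (swapCells T c c') (swapCells S c c') c'
        (isTabloid_swapCells hS (hED hc) (hED hc')) ?_
        (isTabloid_swapCells hT (hED hc) (hED hc')) hc' ?_ ?_
      · obtain ⟨k1, k2, k3, k4, k5⟩ := key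
        refine ⟨k1, k2, k3, fun x hx => ?_, k5⟩
        rw [k4 x hx, swapCells_eq, Function.comp, Equiv.swap_apply_of_ne_of_ne]
        · rintro rfl; exact hx hc
        · rintro rfl; exact hx hc'
      · intro x hx
        rw [swapCells_eq, Function.comp, Equiv.swap_apply_def]
        split_ifs
        · exact hge _ hc'
        · exact hge _ hc
        · exact hge _ hx
      · simp [swapCells_eq, hSc]
      · have hf : {d | d ∈ E ∧ d.1 + d.2 < c.1 + c.2}.Finite := hfin.subset (fun x hx => hx.1)
        have : {d | d ∈ E ∧ d.1 + d.2 < c'.1 + c'.2}.ncard <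
            {d | d ∈ E ∧ d.1 + d.2 < c.1 + c.2}.ncard := by
          apply Set.ncard_lt_ncard _ hf
          refine ⟨fun x hx => ⟨hx.1, hx.2.trans hlt⟩, fun h => ?_⟩
          exact lt_irrefl _ (h (show c' ∈ _ from ⟨hc', hlt⟩)).2
        omega

theorem isTabloid_finite {D : Set (ℕ × ℕ)} {f : ℕ × ℕ → ℕ} (hf : IsTabloid D f) : D.Finite :=
  hf.1.finite_iff_finite.2 (Set.finite_Icc _ _)

theorem BJaux_spec {D : Set (ℕ × ℕ)} {S' T' : ℕ × ℕ → ℕ} (hS : IsTabloid D S')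
    (hT : IsTabloid D T') : ∀ k, k ≤ D.ncard →
      IsTabloid D (BJaux D k (S', T')).1 ∧ IsTabloid D (BJaux D k (S', T')).2 ∧
      ∀ c ∈ D, (BJaux D k (S', T')).1 c ≤ k → ∀ d ∈ D, NbLU d c →
        (BJaux D k (S', T')).1 d < (BJaux D k (S', T')).1 c := by
  have hfin := isTabloid_finite hS
  intro k
  induction k with
  | zero =>
    intro _
    refine ⟨hS, hT, fun c hc h0 => ?_⟩
    have := (hS.1.mapsTo hc).1
    simp only [BJaux] at h0
    omega
  | succ i ih =>
    intro hk
    obtain ⟨h1, h2, h3⟩ := ih (by omega)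
    simp only [BJaux]
    generalize BJaux D i (S', T') = p at h1 h2 h3
    obtain ⟨S, T⟩ := p
    simp only at h1 h2 h3 ⊢
    have hcell : cellOf D S (i + 1) ∈ D ∧ S (cellOf D S (i + 1)) = i + 1 := by
      obtain ⟨x, hx, hxe⟩ := h1.1.surjOn (show i + 1 ∈ Set.Icc 1 D.ncard from ⟨by omega, hk⟩)
      exact Classical.epsilon_spec (p := fun c => c ∈ D ∧ S c = i + 1) ⟨x, hx, hxe⟩
    set E : Set (ℕ × ℕ) := {c | c ∈ D ∧ i + 1 ≤ S c} with hE
    have hED : E ⊆ D := fun x hx => hx.1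
    obtain ⟨k1, k2, k3, k4, k5, k6, k7⟩ := bjIter_spec (hfin.subset hED) hED (i + 1) D.ncard T S
      (cellOf D S (i + 1)) h1 (fun x hx => hx.2) h2 ⟨hcell.1, hcell.2.ge⟩ hcell.2
      (Set.ncard_le_ncard (fun x hx => hx.1.1) hfin)
    generalize bjIter E D.ncard (T, S) (cellOf D S (i + 1)) = q at *
    refine ⟨k2, k1, fun c hc hle d hd hdc => ?_⟩
    by_cases hcE : c ∈ E
    · have hci : q.1.2 c = i + 1 := le_antisymm hle (k3 c hcE)
      have hcq : c = q.2 := k2.1.injOn hc (hED k5) (hci.trans k6.symm)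
      have hdE := k7 d (hcq ▸ hdc)
      rw [hci, k4 d hdE]
      by_contra hcon
      exact hdE ⟨hd, by omega⟩
    · have hSc : S c ≤ i := by
        by_contra hcon
        exact hcE ⟨hc, by omega⟩
      have hlt := h3 c hc hSc d hd hdc
      have hdE : d ∉ E := fun h => by
        have := h.2
        omega
      rw [k4 d hdE, k4 c hcE]
      exact hlt

/-- if `(T,S) = BJ(S',T')` for a tabloid `S'` and a standard
skew tableau `T'` of the same (shifted or unshifted) skew shape, then `S` is a
standard skew tableau. -/
theorem bj_snd_isStandard (sh : SkewShape) (S' T' : ℕ × ℕ → ℕ)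
    (hS' : IsTabloid sh.cells S') (hT' : IsStandard sh.cells T') :
    IsStandard sh.cells (BJ sh.cells S' T').2 := by
  obtain ⟨h1, -, h3⟩ := BJaux_spec hS' hT'.1 sh.cells.ncard le_rfl
  refine ⟨h1, fun c hc => ⟨fun hr => ?_, fun hd => ?_⟩⟩
  · exact h3 _ hr (h1.1.mapsTo hr).2 c hc (Or.inl rfl)
  · exact h3 _ hd (h1.1.mapsTo hd).2 c hc (Or.inr rfl)
end

section
/- Let P and Q be standard skew tableaux of the same (shifted or unshifted) skew shape with n cells and let π be a permutation of {1,…,n}. Then MJ_P(P_π) = Q if and only if FJ(P_π, P) = (Q_{π⁻¹}, Q). In particular, throughout the application of FJ to the pair (P_π, P), the first tabloid of the current pair is obtained from the second tabloid by replacing every entry i by π(i). -/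
open scoped Classical

theorem aux_fst (D : Set (ℕ × ℕ)) (m : ℕ) (f g h : ℕ × ℕ → ℕ) (c : ℕ × ℕ) :
    (fjIter D m (f, g) c).1.1 = (fjIter D m (f, h) c).1.1 := by
  induction m generalizing f g h c with
  | zero => rfl
  | succ m ih =>
    simp only [fjIter]
    cases fjTarget D f c with
    | none => rfl
    | some c' => exact ih _ _ _ _

theorem aux_target (D : Set (ℕ × ℕ)) (f : ℕ × ℕ → ℕ) (c c' : ℕ × ℕ)
    (h : fjTarget D f c = some c') : c' ∈ D := by
  unfold fjTarget at h
  simp only at h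
  split_ifs at h with h1 h2
  · cases h
    rw [min_eq_left h2] at h1
    by_contra hc
    simp [jval, hc] at h1
  · cases h
    rw [min_eq_right (not_le.mp h2).le] at h1
    by_contra hc
    simp [jval, hc] at h1

def auxInv (D : Set (ℕ × ℕ)) (π : Equiv.Perm ℕ)
    (p : (ℕ × ℕ → ℕ) × (ℕ × ℕ → ℕ)) : Prop :=
  (∀ c, p.1 c = π (p.2 c)) ∧ ∀ c, c ∉ D → p.2 c = 0

theorem aux_iter (D : Set (ℕ × ℕ)) (π : Equiv.Perm ℕ) (m : ℕ)
    (p : (ℕ × ℕ → ℕ) × (ℕ × ℕ → ℕ)) (c : ℕ × ℕ) (hc : c ∈ D)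
    (hp : auxInv D π p) : auxInv D π (fjIter D m p c).1 := by
  induction m generalizing p c with
  | zero => exact hp
  | succ m ih =>
    simp only [fjIter]
    cases ht : fjTarget D p.1 c with
    | none => exact hp
    | some c' =>
      have hc' := aux_target D p.1 c c' ht
      refine ih _ _ hc' ⟨fun x => ?_, fun x hx => ?_⟩
      · simp only [swapCells, Function.update_apply]
        split_ifs <;> exact hp.1 _
      · have h1 : x ≠ c := fun h => hx (h ▸ hc)
        have h2 : x ≠ c' := fun h => hx (h ▸ hc')
        simp only [swapCells, Function.update_apply, h1, h2, if_false]
        exact hp.2 x hx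

theorem aux_cellOf (D : Set (ℕ × ℕ)) (P : ℕ × ℕ → ℕ) (hP : IsTabloid D P) (k : ℕ)
    (hk : k < D.ncard) : cellOf D P (D.ncard - k) ∈ D := by
  have h : ∃ c, c ∈ D ∧ P c = D.ncard - k := by
    have := hP.1.surjOn (show D.ncard - k ∈ Set.Icc 1 D.ncard from ⟨by omega, by omega⟩)
    exact this
  exact (Classical.epsilon_spec h).1

theorem aux_MJ (D : Set (ℕ × ℕ)) (S T : ℕ × ℕ → ℕ) (n k : ℕ) :
    MJaux D S n k T = (FJaux D S n k (T, S)).1 := by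
  induction k with
  | zero => rfl
  | succ k ih =>
    simp only [MJaux, FJaux, fjRun, ih]
    exact aux_fst D _ _ _ _ _

theorem aux_FJ (D : Set (ℕ × ℕ)) (π : Equiv.Perm ℕ) (P : ℕ × ℕ → ℕ) (hP : IsTabloid D P)
    (p : (ℕ × ℕ → ℕ) × (ℕ × ℕ → ℕ)) (hp : auxInv D π p) (k : ℕ)
    (hk : k ≤ D.ncard) : auxInv D π (FJaux D P D.ncard k p) := by
  induction k with
  | zero => exact hp
  | succ k ih =>
    exact aux_iter D π _ _ _ (aux_cellOf D P hP k (by omega)) (ih (by omega))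

/-- for standard skew tableaux `P, Q` of the same (shifted or
unshifted) skew shape with `n` cells and a permutation `π` of `{1,…,n}`,
`MJ_P(P_π) = Q` iff `FJ(P_π, P) = (Q_{π⁻¹}, Q)`; moreover, throughout the
application of `FJ` to `(P_π, P)` the first tabloid of the current pair is
obtained from the second one by replacing every entry `i` by `π i`. -/
theorem mj_iff_fj_and_invariant (sh : SkewShape) (P Q : ℕ × ℕ → ℕ)
    (hP : IsStandard sh.cells P) (hQ : IsStandard sh.cells Q)
    (π : Equiv.Perm ℕ) (hπ : PermOn sh.cells.ncard π) :
    (MJ sh.cells P (permApply sh.cells π P) = Q ↔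
      FJ sh.cells (permApply sh.cells π P) P =
        (permApply sh.cells π.symm Q, Q)) ∧
    (∀ k ≤ sh.cells.ncard,
      (FJaux sh.cells P sh.cells.ncard k (permApply sh.cells π P, P)).1 =
        permApply sh.cells π
          (FJaux sh.cells P sh.cells.ncard k (permApply sh.cells π P, P)).2) := by
  have h0 : π 0 = 0 := hπ 0 (by simp)
  have hinit : auxInv sh.cells π (permApply sh.cells π P, P) := by
    refine ⟨fun c => ?_, hP.1.2⟩
    by_cases hc : c ∈ sh.cells
    · simp [permApply, hc]
    · simp [permApply, hc, hP.1.2 c hc, h0]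
  have hinv := aux_FJ sh.cells π P hP.1 _ hinit
  refine ⟨?_, fun k hk => ?_⟩
  · have h := hinv _ le_rfl
    unfold MJ FJ
    rw [aux_MJ]
    generalize FJaux sh.cells P sh.cells.ncard sh.cells.ncard
      (permApply sh.cells π P, P) = p at h
    obtain ⟨a, b⟩ := p
    simp only [Prod.swap_prod_mk, Prod.mk.injEq]
    refine ⟨fun hq => ⟨?_, hq⟩, fun hq => hq.2⟩
    funext c
    by_cases hc : c ∈ sh.cells
    · have h1 : a c = π (b c) := h.1 c
      simp [permApply, hc, ← hq, h1]
    · simpa [permApply, hc] using h.2 c hc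
  · funext c
    have h := hinv k hk
    by_cases hc : c ∈ sh.cells
    · simpa [permApply, hc] using h.1 c
    · simp [permApply, hc, h.1 c, h.2 c hc, h0]
end
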